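/- arXiv:1605.01758 — 2 statements merged into one kernel-verified Lean document; each statement's English description precedes it below -/
import Mathlib

section
/- Let G = (V,E) and G' = (V',E') be finite simple graphs. Then Δ(G,G') equals the minimum, over all bijective functions f : S → S' with S ⊆ V and S' ⊆ V', of the degree mismatch count δ_f. -/
/-- The degree of a vertex: the number of its neighbors. -/
noncomputable def deg {V : Type*} (G : SimpleGraph V) (v : V) : ℕ :=
  (G.neighborSet v).ncard

/-- The degree function of a graph: `degFun G k` is the number of vertices of degree `k`. -/
noncomputable def degFun {V : Type*} (G : SimpleGraph V) (k : ℕ) : ℕ :=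
  {v : V | deg G v = k}.ncard

/-- The degree sequence edit distance `Δ(G, G') = Σ_k |df_G(k) − df_{G'}(k)|`. -/
noncomputable def dsed {V V' : Type*} (G : SimpleGraph V) (G' : SimpleGraph V') : ℕ :=
  ∑' k : ℕ, Nat.dist (degFun G k) (degFun G' k)

/-- The degree mismatch count `δ_f` of a bijection `f : S → S'` between subsets of the
vertex sets of `G` and `G'`: the number of vertices, in either graph, that are
mapped to a vertex of different degree or left unmapped. -/
noncomputable def mismatchCount {V V' : Type*} [Fintype V] [Fintype V']
    [DecidableEq V] [DecidableEq V'] (G : SimpleGraph V) (G' : SimpleGraph V')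
    (S : Finset V) (S' : Finset V') (f : {v // v ∈ S} ≃ {v' // v' ∈ S'}) : ℕ :=
  {v : {v // v ∈ S} | deg G ↑v ≠ deg G' ↑(f v)}.ncard + (Finset.univ \ S).card +
    {v' : {v' // v' ∈ S'} | deg G' ↑v' ≠ deg G ↑(f.symm v')}.ncard +
    (Finset.univ \ S').card

theorem degFun_eq_card_filter {V : Type*} [Fintype V] (G : SimpleGraph V) (k : ℕ) :
    degFun G k = (Finset.univ.filter fun v => deg G v = k).card := by
  rw [degFun, ← Set.ncard_coe_finset]
  simp

/-- Summed over any range containing all degrees, the degree function counts the vertices. -/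
theorem sum_range_degFun {V : Type*} [Fintype V] (G : SimpleGraph V) {N : ℕ}
    (hN : ∀ v, deg G v < N) : ∑ k ∈ Finset.range N, degFun G k = Fintype.card V := by
  simp only [degFun_eq_card_filter]
  exact (Finset.card_eq_sum_card_fiberwise (s := Finset.univ) (f := deg G)
    (t := Finset.range N) (fun v _ => by simpa using hN v)).symm

theorem degFun_eq_zero {V : Type*} (G : SimpleGraph V) {k : ℕ} (h : ∀ v, deg G v < k) :
    degFun G k = 0 := by
  have : {v : V | deg G v = k} = ∅ := by
    ext v
    simpa using (h v).ne
  rw [degFun, this, Set.ncard_empty]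

theorem dsed_add_two_mul_sum_min {V V' : Type*} [Fintype V] [Fintype V']
    (G : SimpleGraph V) (G' : SimpleGraph V') {N : ℕ}
    (hN : ∀ v, deg G v < N) (hN' : ∀ v, deg G' v < N) :
    dsed G G' + 2 * ∑ k ∈ Finset.range N, min (degFun G k) (degFun G' k) =
      Fintype.card V + Fintype.card V' := by
  rw [dsed, tsum_eq_sum (s := Finset.range N), ← sum_range_degFun G hN,
    ← sum_range_degFun G' hN', Finset.mul_sum, ← Finset.sum_add_distrib,
    ← Finset.sum_add_distrib]
  · refine Finset.sum_congr rfl fun k _ => ?_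
    rw [Nat.dist]
    omega
  · intro k hk
    have hk : N ≤ k := by simpa using hk
    rw [degFun_eq_zero G fun v => (hN v).trans_le hk,
      degFun_eq_zero G' fun v => (hN' v).trans_le hk, Nat.dist_self]

theorem mismatchCount_add_two_mul_card_match {V V' : Type*} [Fintype V] [Fintype V']
    [DecidableEq V] [DecidableEq V'] (G : SimpleGraph V) (G' : SimpleGraph V')
    (S : Finset V) (S' : Finset V') (f : {v // v ∈ S} ≃ {v' // v' ∈ S'}) :
    mismatchCount G G' S S' f +
        2 * (Finset.univ.filter fun v : {v // v ∈ S} => deg G v = deg G' (f v)).card =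
      Fintype.card V + Fintype.card V' := by
  have h₁ : {v : {v // v ∈ S} | deg G ↑v ≠ deg G' ↑(f v)}.ncard =
      (Finset.univ.filter fun v : {v // v ∈ S} => ¬ deg G v = deg G' (f v)).card := by
    rw [← Set.ncard_coe_finset]
    simp
  have h₂ : {v' : {v' // v' ∈ S'} | deg G' ↑v' ≠ deg G ↑(f.symm v')}.ncard =
      {v : {v // v ∈ S} | deg G ↑v ≠ deg G' ↑(f v)}.ncard := by
    rw [← Set.ncard_image_of_injective _ f.injective]
    congr 1
    ext v'
    obtain ⟨v, rfl⟩ := f.surjective v'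
    simp [ne_comm]
  have h₃ := Finset.card_filter_add_card_filter_not (s := Finset.univ)
    (fun v : {v // v ∈ S} => deg G v = deg G' (f v))
  have h₄ := Finset.card_sdiff_add_card_eq_card (Finset.subset_univ S)
  have h₅ := Finset.card_sdiff_add_card_eq_card (Finset.subset_univ S')
  have h₆ := Fintype.card_congr f
  simp only [Finset.card_univ, Fintype.card_coe] at h₃ h₄ h₅ h₆
  rw [mismatchCount, h₂, h₁]
  omega

theorem card_match_le_sum_min {V V' : Type*} [Fintype V] [Fintype V']
    (G : SimpleGraph V) (G' : SimpleGraph V')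
    (S : Finset V) (S' : Finset V') (f : {v // v ∈ S} ≃ {v' // v' ∈ S'}) {N : ℕ}
    (hN : ∀ v, deg G v < N) :
    (Finset.univ.filter fun v : {v // v ∈ S} => deg G v = deg G' (f v)).card ≤
      ∑ k ∈ Finset.range N, min (degFun G k) (degFun G' k) := by
  rw [Finset.card_eq_sum_card_fiberwise (f := fun v : {v // v ∈ S} => deg G v)
    (t := Finset.range N) (fun v _ => by simpa using hN v)]
  refine Finset.sum_le_sum fun k _ => le_min ?_ ?_ <;> rw [degFun_eq_card_filter]
  · refine Finset.card_le_card_of_injOn (fun v => (v : V)) (fun v hv => ?_)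
      Subtype.val_injective.injOn
    simp only [Finset.coe_filter, Finset.mem_filter, Finset.mem_univ, true_and,
      Set.mem_ofPred_eq] at hv ⊢
    omega
  · refine Finset.card_le_card_of_injOn (fun v => (f v : V')) (fun v hv => ?_)
      (Subtype.val_injective.comp f.injective).injOn
    simp only [Finset.coe_filter, Finset.mem_filter, Finset.mem_univ, true_and,
      Set.mem_ofPred_eq] at hv ⊢
    omega

/-- A set of vertices can be chosen having any prescribed number, up to the degree function,
of vertices of each degree. -/
theorem exists_finset_card_filter_deg {V : Type*} [Fintype V] (G : SimpleGraph V) (m : ℕ → ℕ)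
    (hm : ∀ k, m k ≤ degFun G k) :
    ∃ S : Finset V, ∀ k, (S.filter fun v => deg G v = k).card = m k := by
  classical
  simp only [degFun_eq_card_filter] at hm
  choose P hP hPm using fun k => Finset.exists_subset_card_eq (hm k)
  refine ⟨Finset.univ.filter fun v => v ∈ P (deg G v), fun k => ?_⟩
  rw [← hPm k]
  congr 1
  ext v
  have := @hP k v
  simp only [Finset.mem_filter, Finset.mem_univ, true_and] at this ⊢
  grind

theorem exists_equiv_deg_eq {V V' : Type*} [Fintype V] [Fintype V']
    (G : SimpleGraph V) (G' : SimpleGraph V') :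
    ∃ (S : Finset V) (S' : Finset V') (f : {v // v ∈ S} ≃ {v' // v' ∈ S'}),
      (∀ v, deg G' (f v) = deg G v) ∧
      ∀ k, (S.filter fun v => deg G v = k).card = min (degFun G k) (degFun G' k) := by
  classical
  obtain ⟨S, hS⟩ := exists_finset_card_filter_deg G
    (fun k => min (degFun G k) (degFun G' k)) fun _ => min_le_left _ _
  obtain ⟨S', hS'⟩ := exists_finset_card_filter_deg G'
    (fun k => min (degFun G k) (degFun G' k)) fun _ => min_le_right _ _
  have e (k : ℕ) : Nonempty ({v : {v // v ∈ S} // deg G v = k} ≃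
      {v' : {v' // v' ∈ S'} // deg G' v' = k}) := by
    have h : Fintype.card {v // v ∈ S.filter fun v => deg G v = k} =
        Fintype.card {v' // v' ∈ S'.filter fun v' => deg G' v' = k} := by
      rw [Fintype.card_coe, Fintype.card_coe, hS, hS']
    exact ⟨(Equiv.subtypeSubtypeEquivSubtypeInter (· ∈ S) (deg G · = k)).trans <|
      (Equiv.subtypeEquivRight fun v => by simp).trans <|
      (Fintype.equivOfCardEq h).trans <|
      (Equiv.subtypeEquivRight fun v => by simp).trans
      (Equiv.subtypeSubtypeEquivSubtypeInter (· ∈ S') (deg G' · = k)).symm⟩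
  exact ⟨S, S', Equiv.ofFiberEquiv (f := fun v : {v // v ∈ S} => deg G v)
    (g := fun v' : {v' // v' ∈ S'} => deg G' v') fun k => (e k).some,
    fun v => Equiv.ofFiberEquiv_map (f := fun v : {v // v ∈ S} => deg G v)
      (g := fun v' : {v' // v' ∈ S'} => deg G' v') _ v, hS⟩

/-- `Δ(G,G')` is the minimum degree mismatch count over all bijective partial mappings
between the vertex sets of `G` and `G'`. -/
theorem dsed_eq_min_mismatchCount {V V' : Type*} [Fintype V] [Fintype V']
    [DecidableEq V] [DecidableEq V'] (G : SimpleGraph V) (G' : SimpleGraph V') :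
    dsed G G' = sInf {d : ℕ | ∃ (S : Finset V) (S' : Finset V')
      (f : {v // v ∈ S} ≃ {v' // v' ∈ S'}), d = mismatchCount G G' S S' f} := by
  obtain ⟨N, hN, hN'⟩ : ∃ N, (∀ v, deg G v < N) ∧ ∀ v, deg G' v < N := by
    refine ⟨Finset.univ.sup (deg G) + Finset.univ.sup (deg G') + 1, fun v => ?_, fun v => ?_⟩
    · have := Finset.le_sup (f := deg G) (Finset.mem_univ v)
      omega
    · have := Finset.le_sup (f := deg G') (Finset.mem_univ v)
      omega
  have hΔ := dsed_add_two_mul_sum_min G G' hN hN'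
  refine (IsLeast.csInf_eq ⟨?_, ?_⟩).symm
  · obtain ⟨S, S', f, hf, hS⟩ := exists_equiv_deg_eq G G'
    refine ⟨S, S', f, ?_⟩
    have hδ := mismatchCount_add_two_mul_card_match G G' S S' f
    have hcard := Finset.card_eq_sum_card_fiberwise (s := S) (f := deg G)
      (t := Finset.range N) (fun v _ => by simpa using hN v)
    simp only [hS] at hcard
    simp only [hf, Finset.filter_true, Finset.card_univ, Fintype.card_coe] at hδ
    omega
  · rintro _ ⟨S, S', f, rfl⟩
    have hδ := mismatchCount_add_two_mul_card_match G G' S S' f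
    have hle := card_match_le_sum_min G G' S S' f hN
    omega
end

section
/- Let G₁ and G₂ be finite simple graphs each on n ≥ 2 vertices, let v₁ be a universal vertex of G₁ (adjacent to all other vertices of G₁) and let v₂ be a universal vertex of G₂. Then Δ(G₁, G₂) = Δ(G₁ − v₁, G₂ − v₂), where G − v denotes the subgraph of G induced by deleting the vertex v. -/
/-- Deleting a universal vertex lowers the degree of every other vertex by one. -/
theorem deg_eq_deg_induce_add_one {V : Type*} [Finite V] {G : SimpleGraph V} {v : V}
    (hv : ∀ u, u ≠ v → G.Adj v u) (u : {u | u ≠ v}) :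
    deg G u = deg (G.induce {u | u ≠ v}) u + 1 := by
  have h : G.neighborSet u
      = insert v (Subtype.val '' (G.induce {u | u ≠ v}).neighborSet u) := by
    ext w
    by_cases hw : w = v
    · simp [hw, (hv u u.2).symm]
    · simp [hw]
  rw [deg, deg, h, Set.ncard_insert_of_notMem (by simp),
    Set.ncard_image_of_injective _ Subtype.val_injective]

/-- A universal vertex is adjacent to all vertices but itself. -/
theorem deg_add_one_of_universal {V : Type*} [Finite V] {G : SimpleGraph V} {v : V}
    (hv : ∀ u, u ≠ v → G.Adj v u) : deg G v + 1 = Nat.card V := by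
  have h : G.neighborSet v = {v}ᶜ := by
    ext w
    exact ⟨fun hw => hw.ne', hv w⟩
  rw [deg, h, ← Set.ncard_add_ncard_compl {v}, Set.ncard_singleton, add_comm]

/-- A nontrivial graph with a universal vertex has no isolated vertex. -/
theorem degFun_zero_of_universal {V : Type*} [Finite V] {G : SimpleGraph V} {v : V}
    (hv : ∀ u, u ≠ v → G.Adj v u) (hcard : 2 ≤ Nat.card V) : degFun G 0 = 0 := by
  have h : {u | deg G u = 0} = ∅ := by
    refine Set.eq_empty_of_forall_notMem fun u (hu : deg G u = 0) => ?_
    by_cases huv : u = v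
    · have := deg_add_one_of_universal hv
      subst huv
      omega
    · have := deg_eq_deg_induce_add_one hv ⟨u, huv⟩
      simp only at this
      omega
  rw [degFun, h, Set.ncard_empty]

/-- Deleting a universal vertex shifts the degree function by one, up to the contribution of
that vertex. -/
theorem degFun_succ_of_universal {V : Type*} [Finite V] {G : SimpleGraph V} {v : V}
    (hv : ∀ u, u ≠ v → G.Adj v u) (k : ℕ) :
    degFun G (k + 1)
      = degFun (G.induce {u | u ≠ v}) k + if k + 2 = Nat.card V then 1 else 0 := by
  have hdeg := deg_add_one_of_universal hv
  have himage : Subtype.val '' {u | deg (G.induce {u | u ≠ v}) u = k}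
      = {u | deg G u = k + 1} \ {v} := by
    ext w
    constructor
    · rintro ⟨u, hu, rfl⟩
      exact ⟨(deg_eq_deg_induce_add_one hv u).trans (congrArg (· + 1) hu), u.2⟩
    · rintro ⟨hw, hwv⟩
      exact ⟨⟨w, hwv⟩,
        Nat.succ_injective ((deg_eq_deg_induce_add_one hv ⟨w, hwv⟩).symm.trans hw), rfl⟩
  rw [degFun, degFun, ← Set.ncard_image_of_injective _ Subtype.val_injective, himage]
  split_ifs with h
  · exact (Set.ncard_sdiff_singleton_add_one
      (show v ∈ {u | deg G u = k + 1} from by rw [Set.mem_ofPred_eq]; omega)).symm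
  · rw [Set.sdiff_singleton_eq_self
      (show v ∉ {u | deg G u = k + 1} from by rw [Set.mem_ofPred_eq]; omega), add_zero]

/-- Removing a universal vertex from each of two graphs on `n ≥ 2` vertices leaves
the degree sequence edit distance unchanged. -/
theorem dsed_delete_universal_vertex {V₁ V₂ : Type*} [Fintype V₁] [Fintype V₂]
    [DecidableEq V₁] [DecidableEq V₂] (n : ℕ) (hn : 2 ≤ n)
    (hcard₁ : Fintype.card V₁ = n) (hcard₂ : Fintype.card V₂ = n)
    (G₁ : SimpleGraph V₁) (G₂ : SimpleGraph V₂) (v₁ : V₁) (v₂ : V₂)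
    (hu₁ : ∀ u : V₁, u ≠ v₁ → G₁.Adj v₁ u) (hu₂ : ∀ u : V₂, u ≠ v₂ → G₂.Adj v₂ u) :
    dsed G₁ G₂ = dsed (G₁.induce {u | u ≠ v₁}) (G₂.induce {u | u ≠ v₂}) := by
  have hc₁ : Nat.card V₁ = n := Nat.card_eq_fintype_card.trans hcard₁
  have hc₂ : Nat.card V₂ = n := Nat.card_eq_fintype_card.trans hcard₂
  have hsupp : Function.support (fun k => Nat.dist (degFun G₁ k) (degFun G₂ k))
      ⊆ Set.range Nat.succ := by
    rintro (_ | k) hk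
    · simp [degFun_zero_of_universal hu₁ (hc₁ ▸ hn),
        degFun_zero_of_universal hu₂ (hc₂ ▸ hn)] at hk
    · exact ⟨k, rfl⟩
  rw [dsed, dsed, ← Nat.succ_injective.tsum_eq hsupp]
  refine tsum_congr fun k => ?_
  rw [Nat.succ_eq_add_one, degFun_succ_of_universal hu₁, degFun_succ_of_universal hu₂,
    hc₁, hc₂, Nat.dist_add_add_right]
end
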